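/- arXiv:1903.11057 — 2 statements merged into one kernel-verified Lean document; each statement's English description precedes it below -/
import Mathlib

section
/- For all integers r, n and m: u(2r)·w(n+m) = u(m+r)·w(n+r) − q^(2r)·u(m−r)·w(n−r). -/
/-- A two-sided solution of a second order linear recurrence with invertible trailing coefficient
vanishes as soon as two consecutive initial values do. -/
theorem eq_zero_of_recurrence {K : Type*} [Field K] {p q : K} (hq : q ≠ 0) {f : ℤ → K}
    (hf : ∀ n : ℤ, f (n + 2) = p * f (n + 1) - q * f n) (h0 : f 0 = 0) (h1 : f 1 = 0) (n : ℤ) :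
    f n = 0 := by
  suffices h : f n = 0 ∧ f (n + 1) = 0 from h.1
  induction n using Int.induction_on with
  | zero => exact ⟨h0, by simpa using h1⟩
  | succ i ih =>
    refine ⟨ih.2, ?_⟩
    rw [show (i : ℤ) + 1 + 1 = i + 2 by ring, hf, ih.1, ih.2]
    ring
  | pred i ih =>
    have h := hf (-(i : ℤ) - 1)
    rw [show -(i : ℤ) - 1 + 2 = -i + 1 by ring, sub_add_cancel, ih.1, ih.2] at h
    refine ⟨?_, by rw [sub_add_cancel]; exact ih.1⟩
    have h' : q * f (-(i : ℤ) - 1) = 0 := by linear_combination h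
    exact (mul_eq_zero.mp h').resolve_left hq

/-- The Casoratian of a Lucas sequence of the first kind and a shifted Horadam sequence. -/
theorem lucas_mul_horadam_sub {K : Type*} [Field K] {p q : K} (hq : q ≠ 0) {u w : ℤ → K}
    (hu0 : u 0 = 0) (hu1 : u 1 = 1)
    (hu : ∀ n : ℤ, u (n + 2) = p * u (n + 1) - q * u n)
    (hw : ∀ n : ℤ, w (n + 2) = p * w (n + 1) - q * w n) (n k : ℤ) :
    u (k + 1) * w (n + k) - u k * w (n + k + 1) = q ^ k * w n := by
  have step (k : ℤ) : u (k + 1 + 1) * w (n + (k + 1)) - u (k + 1) * w (n + (k + 1) + 1) =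
      q * (u (k + 1) * w (n + k) - u k * w (n + k + 1)) := by
    rw [show k + 1 + 1 = k + 2 by ring, show n + (k + 1) + 1 = n + k + 2 by ring,
      show n + (k + 1) = n + k + 1 by ring, hu, hw]
    ring
  induction k using Int.induction_on with
  | zero => simp [hu0, hu1]
  | succ i ih => rw [step, ih, zpow_add_one₀ hq]; ring
  | pred i ih =>
    have h := step (-(i : ℤ) - 1)
    rw [sub_add_cancel, ih] at h
    apply mul_left_cancel₀ hq
    rw [sub_add_cancel, ← h, zpow_sub_one₀ hq]
    field_simp

/-- The d'Ocagne-type identity for a Lucas sequence of the first kind and a Horadam sequence. -/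
theorem lucas_mul_horadam_add {K : Type*} [Field K] {p q : K} (hq : q ≠ 0) {u w : ℤ → K}
    (hu0 : u 0 = 0) (hu1 : u 1 = 1)
    (hu : ∀ n : ℤ, u (n + 2) = p * u (n + 1) - q * u n)
    (hw : ∀ n : ℤ, w (n + 2) = p * w (n + 1) - q * w n) (n k m : ℤ) :
    u k * w (n + k + m) = u (k + m) * w (n + k) - q ^ k * u m * w n := by
  have h := eq_zero_of_recurrence (p := p) hq
    (f := fun m => u k * w (n + k + m) - (u (k + m) * w (n + k) - q ^ k * u m * w n))
    (fun m => by
      simp only [← add_assoc, hu, hw]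
      ring)
    (by simp [hu0])
    (by
      simp only [hu1]
      linear_combination -lucas_mul_horadam_sub hq hu0 hu1 hu hw n k) m
  exact sub_eq_zero.mp h

theorem stmt_10 (p q a b : ℂ) (hq : q ≠ 0) (w u : ℤ → ℂ)
    (hw0 : w 0 = a) (hw1 : w 1 = b)
    (hw : ∀ n : ℤ, w n = p * w (n - 1) - q * w (n - 2))
    (hu0 : u 0 = 0) (hu1 : u 1 = 1)
    (hu : ∀ n : ℤ, u n = p * u (n - 1) - q * u (n - 2))
    (r n m : ℤ) :
    u (2 * r) * w (n + m) = u (m + r) * w (n + r) - q ^ (2 * r) * u (m - r) * w (n - r) := by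
  have shift {f : ℤ → ℂ} (hf : ∀ n : ℤ, f n = p * f (n - 1) - q * f (n - 2)) (n : ℤ) :
      f (n + 2) = p * f (n + 1) - q * f n := by
    rw [hf (n + 2), show n + 2 - 1 = n + 1 by ring, add_sub_cancel_right]
  have h := lucas_mul_horadam_add hq hu0 hu1 (shift hu) (shift hw) (n - r) (2 * r) (m - r)
  rwa [show n - r + 2 * r + (m - r) = n + m by ring, show 2 * r + (m - r) = m + r by ring,
    show n - r + 2 * r = n + r by ring] at h
end

section
/- For every natural number k and all integers r, s, n, m: u(r−s)·∑_{j=0}^{k} q^{(s−r)j}·w(m+s)^{k−j}·w(m+r)^j·w(n−(r−s)k+m+s+(r−s)j) = q^{(s−r)k}·u(n)·w(m+r)^{k+1} − q^{r−s}·u(n−(r−s)(k+1))·w(m+s)^{k+1}. -/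
/-- A two-sided sequence satisfying a second-order linear recurrence with invertible last
coefficient vanishes identically once two consecutive values vanish. -/
theorem recurrence_eq_zero {p q : ℂ} (hq : q ≠ 0) {f : ℤ → ℂ}
    (hf : ∀ n : ℤ, f n = p * f (n - 1) - q * f (n - 2)) (h0 : f 0 = 0) (h1 : f 1 = 0)
    (n : ℤ) : f n = 0 := by
  suffices h : f n = 0 ∧ f (n + 1) = 0 from h.1
  induction n using Int.induction_on with
  | zero => simpa using ⟨h0, h1⟩
  | succ i ih =>
    refine ⟨ih.2, ?_⟩
    rw [hf, show (i : ℤ) + 1 + 1 - 1 = i + 1 by ring, show (i : ℤ) + 1 + 1 - 2 = i by ring,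
      ih.1, ih.2]
    ring
  | pred i ih =>
    have h := hf (-(i : ℤ) + 1)
    rw [show -(i : ℤ) + 1 - 1 = -i by ring, show -(i : ℤ) + 1 - 2 = -i - 1 by ring,
      ih.1, ih.2] at h
    refine ⟨?_, by simpa using ih.1⟩
    have h2 : q * f (-(i : ℤ) - 1) = 0 := by linear_combination h
    exact (mul_eq_zero.mp h2).resolve_left hq

section Horadam

variable {p q : ℂ} {w u : ℤ → ℂ}

/-- The addition formula expressing a Horadam sequence through the Lucas sequence. -/
theorem horadam_add (hq : q ≠ 0) (hw : ∀ n : ℤ, w n = p * w (n - 1) - q * w (n - 2))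
    (hu0 : u 0 = 0) (hu1 : u 1 = 1) (hu : ∀ n : ℤ, u n = p * u (n - 1) - q * u (n - 2))
    (m n : ℤ) : w (n + m) = u n * w (m + 1) - q * u (n - 1) * w m := by
  have hneg : q * u (-1) = -1 := by
    have h := hu 1
    norm_num [hu0, hu1] at h
    linear_combination h
  refine sub_eq_zero.mp (recurrence_eq_zero (p := p) hq
    (f := fun n => w (n + m) - (u n * w (m + 1) - q * u (n - 1) * w m)) ?_ ?_ ?_ n)
  · intro n
    have h1 := hw (n + m)
    have h2 := hu n
    have h3 := hu (n - 1)
    rw [show n + m - 1 = n - 1 + m by ring, show n + m - 2 = n - 2 + m by ring] at h1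
    rw [show n - 1 - 2 = n - 2 - 1 by ring, show n - 1 - 1 = n - 2 by ring] at h3
    simp only [show n - 1 - 1 = n - 2 by ring]
    linear_combination h1 - w (m + 1) * h2 + q * w m * h3
  · simp only [zero_add, zero_sub, hu0]
    linear_combination w m * hneg
  · simp [hu0, hu1, add_comm]

/-- The Ocagne identity for the Lucas sequence of the first kind. -/
theorem zpow_mul_lucas_sub (hq : q ≠ 0) (hu0 : u 0 = 0) (hu1 : u 1 = 1)
    (hu : ∀ n : ℤ, u n = p * u (n - 1) - q * u (n - 2)) (n d : ℤ) :
    q ^ d * u (n - d) = u n * u (d + 1) - u (n + 1) * u d := by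
  refine sub_eq_zero.mp (recurrence_eq_zero (p := p) hq
    (f := fun d => q ^ d * u (n - d) - (u n * u (d + 1) - u (n + 1) * u d)) ?_ ?_ ?_ d)
  · intro d
    have h1 := hu (n - (d - 2))
    have h2 := hu (d + 1)
    have h3 := hu d
    rw [show n - (d - 2) - 1 = n - (d - 1) by ring, show n - (d - 2) - 2 = n - d by ring] at h1
    rw [show d + 1 - 1 = d - 1 + 1 by ring, show d + 1 - 2 = d - 2 + 1 by ring] at h2
    have e1 : q ^ d = q ^ (d - 2) * q * q := by
      rw [← zpow_add_one₀ hq, ← zpow_add_one₀ hq]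
      ring_nf
    have e2 : q ^ (d - 1) = q ^ (d - 2) * q := by
      rw [← zpow_add_one₀ hq]
      ring_nf
    simp only [e1, e2]
    linear_combination q ^ (d - 2) * q * h1 - u n * h2 + u (n + 1) * h3
  · simp [hu0, hu1]
  · have h := hu (n + 1)
    have h2 := hu 2
    rw [show n + 1 - 1 = n by ring, show n + 1 - 2 = n - 1 by ring] at h
    norm_num [hu0, hu1] at h2 ⊢
    linear_combination h - u n * h2

theorem lucas_mul_horadam (hq : q ≠ 0) (hw : ∀ n : ℤ, w n = p * w (n - 1) - q * w (n - 2))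
    (hu0 : u 0 = 0) (hu1 : u 1 = 1) (hu : ∀ n : ℤ, u n = p * u (n - 1) - q * u (n - 2))
    (m n d : ℤ) :
    u d * w (n + m) = u n * w (d + m) - q ^ d * u (n - d) * w m := by
  have h1 := hu (d + 1)
  have h2 := hu (n + 1)
  rw [show d + 1 - 1 = d by ring, show d + 1 - 2 = d - 1 by ring] at h1
  rw [show n + 1 - 1 = n by ring, show n + 1 - 2 = n - 1 by ring] at h2
  rw [zpow_mul_lucas_sub hq hu0 hu1 hu, horadam_add hq hw hu0 hu1 hu m n,
    horadam_add hq hw hu0 hu1 hu m d]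
  linear_combination w m * (u n * h1 - u d * h2)

end Horadam


theorem stmt_16 (p q a b : ℂ) (hq : q ≠ 0) (w u : ℤ → ℂ)
    (hw0 : w 0 = a) (hw1 : w 1 = b)
    (hw : ∀ n : ℤ, w n = p * w (n - 1) - q * w (n - 2))
    (hu0 : u 0 = 0) (hu1 : u 1 = 1)
    (hu : ∀ n : ℤ, u n = p * u (n - 1) - q * u (n - 2))
    (k : ℕ) (r s n m : ℤ) :
    u (r - s) * ∑ j ∈ Finset.range (k + 1), q ^ ((s - r) * (j : ℤ)) * w (m + s) ^ (k - j) * w (m + r) ^ j * w (n - (r - s) * k + m + s + (r - s) * j) = q ^ ((s - r) * (k : ℤ)) * u n * w (m + r) ^ (k + 1) - q ^ (r - s) * u (n - (r - s) * (k + 1)) * w (m + s) ^ (k + 1) := by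
  have key (j : ℕ) (hj : j ∈ Finset.range (k + 1)) :
      u (r - s) * (q ^ ((s - r) * (j : ℤ)) * w (m + s) ^ (k - j) * w (m + r) ^ j *
          w (n - (r - s) * k + m + s + (r - s) * j)) =
        q ^ ((s - r) * ((j + 1 : ℕ) - 1 : ℤ)) * w (m + s) ^ (k + 1 - (j + 1)) *
            w (m + r) ^ (j + 1) * u (n - (r - s) * (k + 1 - (j + 1 : ℕ))) -
          q ^ ((s - r) * (j - 1 : ℤ)) * w (m + s) ^ (k + 1 - j) *
            w (m + r) ^ j * u (n - (r - s) * (k + 1 - j)) := by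
    have hjk : j ≤ k := Nat.lt_succ_iff.mp (Finset.mem_range.mp hj)
    have h := lucas_mul_horadam hq hw hu0 hu1 hu (m + s) (n - (r - s) * (k - j)) (r - s)
    rw [show n - (r - s) * (k - j) + (m + s) = n - (r - s) * k + m + s + (r - s) * j by ring,
      show r - s + (m + s) = m + r by ring,
      show n - (r - s) * (k - j) - (r - s) = n - (r - s) * (k + 1 - j) by ring] at h
    have e : q ^ ((s - r) * (j - 1 : ℤ)) = q ^ ((s - r) * (j : ℤ)) * q ^ (r - s) := by
      rw [← zpow_add₀ hq]
      ring_nf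
    rw [e, Nat.add_sub_add_right, Nat.sub_add_comm hjk,
      show ((j + 1 : ℕ) : ℤ) - 1 = j by push_cast; ring,
      show (k : ℤ) + 1 - (j + 1 : ℕ) = k - j by push_cast; ring]
    linear_combination q ^ ((s - r) * (j : ℤ)) * w (m + s) ^ (k - j) * w (m + r) ^ j * h
  rw [Finset.mul_sum, Finset.sum_congr rfl key,
    Finset.sum_range_sub (fun j : ℕ => q ^ ((s - r) * (j - 1 : ℤ)) * w (m + s) ^ (k + 1 - j) *
      w (m + r) ^ j * u (n - (r - s) * (k + 1 - j)))]
  simp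
  ring
end
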